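/- Let n ≥ 1 and α > (n-1)/2. If f ∈ L¹(ℝⁿ) is bounded and uniformly continuous on ℝⁿ, then its Bochner–Riesz means converge uniformly to f: lim_{R → ∞} sup_{t ∈ ℝⁿ} |B_R^α[f](t) - f(t)| = 0. -/

import Mathlib

open MeasureTheory Real Complex Filter
open scoped ENNReal RealInnerProductSpace

/-- Fourier transform `f̂(ξ) = ∫ e^{-2πi⟨x,ξ⟩} f(x) dx` on `ℝⁿ`. -/
noncomputable def fourierT (n : ℕ) (f : EuclideanSpace ℝ (Fin n) → ℂ)
    (ξ : EuclideanSpace ℝ (Fin n)) : ℂ :=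
  ∫ x, Complex.exp (-(2 * Real.pi * ⟪x, ξ⟫ : ℝ) * Complex.I) * f x

/-- Bochner–Riesz kernel `K_{R,α}(z) = ∫ e^{2πi⟨z,ξ⟩} (1-|ξ|²/R²)₊^α dξ`. -/
noncomputable def BRkernel (n : ℕ) (R α : ℝ) (z : EuclideanSpace ℝ (Fin n)) : ℂ :=
  ∫ ξ : EuclideanSpace ℝ (Fin n),
    Complex.exp ((2 * Real.pi * ⟪z, ξ⟫ : ℝ) * Complex.I) *
      (((max (1 - ‖ξ‖ ^ 2 / R ^ 2) 0) ^ α : ℝ) : ℂ)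

/-- Bochner–Riesz operator `B_R^α[f](t) = ∫ e^{2πi⟨t,ξ⟩} (1-|ξ|²/R²)₊^α f̂(ξ) dξ`. -/
noncomputable def BR (n : ℕ) (R α : ℝ) (f : EuclideanSpace ℝ (Fin n) → ℂ)
    (t : EuclideanSpace ℝ (Fin n)) : ℂ :=
  ∫ ξ : EuclideanSpace ℝ (Fin n),
    Complex.exp ((2 * Real.pi * ⟪t, ξ⟫ : ℝ) * Complex.I) *
      (((max (1 - ‖ξ‖ ^ 2 / R ^ 2) 0) ^ α : ℝ) : ℂ) * fourierT n f ξ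

/-- The analytic continuation of `(1 - t²)^β e^{ist}` to a strip of the upper half plane. -/
noncomputable def jacobiExp (β s : ℝ) (z : ℂ) : ℂ :=
  (1 - z ^ 2) ^ (β : ℂ) * Complex.exp (s * z * Complex.I)

lemma norm_jacobiExp (β s x y : ℝ) :
    ‖jacobiExp β s (x + y * Complex.I)‖ =
      ‖1 - ((x : ℂ) + y * Complex.I) ^ 2‖ ^ β * Real.exp (-s * y) := by
  rw [jacobiExp, norm_mul, Complex.norm_cpow_real, Complex.norm_exp]
  congr 2
  simp

lemma norm_one_sub_sq_le_three {x y : ℝ} (hx : |x| ≤ 1) (hy : |y| ≤ 1) :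
    ‖1 - ((x : ℂ) + y * Complex.I) ^ 2‖ ≤ 3 := by
  have h1 : ‖((x : ℂ) + y * Complex.I) ^ 2‖ ≤ 2 := by
    rw [norm_pow, ← Complex.normSq_eq_norm_sq, Complex.normSq_add_mul_I]
    have := (sq_le_one_iff_abs_le_one x).2 hx
    have := (sq_le_one_iff_abs_le_one y).2 hy
    linarith
  calc _ ≤ ‖(1 : ℂ)‖ + ‖((x : ℂ) + y * Complex.I) ^ 2‖ := norm_sub_le _ _
    _ ≤ 3 := by rw [norm_one]; linarith

lemma norm_one_sub_sq_le_mul {x y : ℝ} (hx : x = 1 ∨ x = -1) (hy0 : 0 ≤ y) (hy : y ≤ 1) :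
    ‖1 - ((x : ℂ) + y * Complex.I) ^ 2‖ ≤ 3 * y := by
  have hx2 : (x : ℂ) ^ 2 = 1 := by rcases hx with rfl | rfl <;> simp
  have hxn : |x| = 1 := by rcases hx with rfl | rfl <;> simp
  have : 1 - ((x : ℂ) + y * Complex.I) ^ 2 = y * (y - 2 * x * Complex.I) := by
    linear_combination -hx2 - (y : ℂ) ^ 2 * Complex.I_sq
  rw [this, norm_mul, Complex.norm_real, Real.norm_of_nonneg hy0, mul_comm]
  gcongr
  calc _ ≤ ‖(y : ℂ)‖ + ‖2 * (x : ℂ) * Complex.I‖ := norm_sub_le _ _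
    _ ≤ 3 := by simp [hxn, abs_of_nonneg hy0]; linarith

lemma continuousAt_jacobiExp {β : ℝ} (hβ : 0 < β) (s : ℝ) {z : ℂ} (hz : |z.re| ≤ 1) :
    ContinuousAt (jacobiExp β s) z := by
  have hre : 0 ≤ (1 - z ^ 2).re := by
    have := (sq_le_one_iff_abs_le_one z.re).2 hz
    simp [pow_two] at this ⊢
    nlinarith [mul_self_nonneg z.im]
  have h1 : ContinuousAt (fun w : ℂ ↦ (1 - w ^ 2) ^ (β : ℂ)) z :=
    ContinuousAt.comp (g := fun w : ℂ ↦ w ^ (β : ℂ)) (f := fun w : ℂ ↦ 1 - w ^ 2)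
      (Complex.continuousAt_cpow_const_of_re_pos (Or.inl hre) (by simpa using hβ))
      (by fun_prop)
  exact h1.mul (by fun_prop)

lemma differentiableAt_jacobiExp (β s : ℝ) {z : ℂ} (hz : |z.re| < 1) :
    DifferentiableAt ℂ (jacobiExp β s) z := by
  have hre : 0 < (1 - z ^ 2).re := by
    have := (sq_lt_one_iff_abs_lt_one z.re).2 hz
    simp [pow_two] at this ⊢
    nlinarith [mul_self_nonneg z.im]
  have h1 : DifferentiableAt ℂ (fun w : ℂ ↦ (1 - w ^ 2) ^ (β : ℂ)) z :=
    DifferentiableAt.cpow (by fun_prop) (by fun_prop) (Or.inl hre)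
  exact h1.mul (by fun_prop)

lemma exp_neg_le_mul_rpow_neg {p s : ℝ} (hp : 0 < p) (hs : 0 < s) :
    Real.exp (-s) ≤ p ^ p * s ^ (-p) := by
  have h : s / p ≤ Real.exp (s / p) := by linarith [Real.add_one_le_exp (s / p)]
  have h2 : (s / p) ^ p ≤ Real.exp s := by
    calc (s / p) ^ p ≤ Real.exp (s / p) ^ p := by gcongr
      _ = Real.exp s := by rw [← Real.exp_mul]; congr 1; field_simp
  rw [Real.exp_neg, Real.rpow_neg hs.le, ← div_eq_mul_inv, ← inv_div, ← Real.div_rpow hs.le hp.le]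
  gcongr

lemma integral_rpow_mul_exp_neg_le {β s : ℝ} (hβ : 0 < β) (hs : 0 < s) :
    ∫ y in (0 : ℝ)..1, y ^ β * Real.exp (-s * y) ≤ Real.Gamma (β + 1) * s ^ (-(β + 1)) := by
  have hint : IntegrableOn (fun y : ℝ ↦ y ^ β * Real.exp (-s * y)) (Set.Ioi 0) := by
    simpa using integrableOn_rpow_mul_exp_neg_mul_rpow (p := 1) (by linarith) one_pos hs
  have key := Real.integral_rpow_mul_exp_neg_mul_Ioi (a := β + 1) (by linarith) hs
  rw [intervalIntegral.integral_of_le zero_le_one]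
  calc _ ≤ ∫ y in Set.Ioi (0 : ℝ), y ^ β * Real.exp (-s * y) := by
        refine setIntegral_mono_set hint ?_ (Set.Ioc_subset_Ioi_self.eventuallyLE)
        filter_upwards [ae_restrict_mem measurableSet_Ioi] with y hy
        exact mul_nonneg (Real.rpow_nonneg (le_of_lt hy) _) (Real.exp_pos _).le
    _ = _ := by
        simp only [add_sub_cancel_right] at key
        simp only [neg_mul, key]
        rw [one_div, Real.inv_rpow hs.le, Real.rpow_neg hs.le, mul_comm]

lemma norm_integral_side_le {β s x : ℝ} (hβ : 0 < β) (hs : 0 < s) (hx : x = 1 ∨ x = -1) :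
    ‖∫ y in (0 : ℝ)..1, jacobiExp β s (x + y * Complex.I)‖ ≤
      3 ^ β * (Real.Gamma (β + 1) * s ^ (-(β + 1))) := by
  calc _ ≤ ∫ y in (0 : ℝ)..1, 3 ^ β * (y ^ β * Real.exp (-s * y)) := by
        refine intervalIntegral.norm_integral_le_of_norm_le zero_le_one ?_ ?_
        · refine .of_forall fun y hy ↦ ?_
          rw [norm_jacobiExp, ← mul_assoc, ← Real.mul_rpow (by norm_num) hy.1.le]
          have := norm_one_sub_sq_le_mul hx hy.1.le hy.2
          gcongr
        · refine Continuous.intervalIntegrable ?_ _ _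
          have := Real.continuous_rpow_const hβ.le
          fun_prop
    _ ≤ _ := by
        rw [intervalIntegral.integral_const_mul]
        gcongr
        exact integral_rpow_mul_exp_neg_le hβ hs

/-- Shifting the contour into the upper half plane bounds the Fourier transform of
`(1 - t²)^β` on `[-1, 1]`. -/
lemma exists_norm_integral_jacobiExp_le {β : ℝ} (hβ : 0 < β) :
    ∃ C : ℝ, ∀ s : ℝ, 0 < s →
      ‖∫ t in (-1 : ℝ)..1, jacobiExp β s t‖ ≤ C * s ^ (-(β + 1)) := by
  refine ⟨2 * (3 ^ β * (β + 1) ^ (β + 1)) + 2 * (3 ^ β * Real.Gamma (β + 1)), fun s hs ↦ ?_⟩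
  have rect := Complex.integral_boundary_rect_eq_zero_of_continuousOn_of_differentiableOn
    (jacobiExp β s) (-1) (1 + Complex.I)
    (fun z hz ↦ (continuousAt_jacobiExp hβ s (by
      have := hz.1
      simpa [Set.uIcc_of_le, abs_le] using this)).continuousWithinAt)
    (fun z hz ↦ (differentiableAt_jacobiExp β s (by
      have := hz.1
      simpa [abs_lt] using this)).differentiableWithinAt)
  have top : ‖∫ x in (-1 : ℝ)..1, jacobiExp β s (x + (1 : ℝ) * Complex.I)‖ ≤
      2 * (3 ^ β * (β + 1) ^ (β + 1)) * s ^ (-(β + 1)) := by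
    refine (intervalIntegral.norm_integral_le_of_norm_le_const
      (C := 3 ^ β * Real.exp (-s)) fun x hx ↦ ?_).trans ?_
    · rw [norm_jacobiExp, mul_one]
      rw [Set.uIoc_of_le (by norm_num)] at hx
      have := norm_one_sub_sq_le_three (x := x) (y := 1) (abs_le.2 ⟨hx.1.le, hx.2⟩) (by simp)
      gcongr
    · have := exp_neg_le_mul_rpow_neg (p := β + 1) (by linarith) hs
      have h3 : (0 : ℝ) ≤ 3 ^ β := by positivity
      rw [show |(1 : ℝ) - -1| = 2 by norm_num]
      nlinarith [mul_le_mul_of_nonneg_left this h3]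
  have right := norm_integral_side_le hβ hs (x := 1) (Or.inl rfl)
  have left := norm_integral_side_le hβ hs (x := -1) (Or.inr rfl)
  simp only [Complex.neg_re, Complex.one_re, Complex.neg_im, Complex.one_im, Complex.add_re,
    Complex.add_im, Complex.I_re, Complex.I_im, add_zero, zero_add, neg_zero,
    Complex.ofReal_zero, zero_mul] at rect
  have eq : ∫ t in (-1 : ℝ)..1, jacobiExp β s t =
      (∫ x in (-1 : ℝ)..1, jacobiExp β s (x + (1 : ℝ) * Complex.I))
        - Complex.I • (∫ y in (0 : ℝ)..1, jacobiExp β s ((1 : ℝ) + y * Complex.I))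
        + Complex.I • ∫ y in (0 : ℝ)..1, jacobiExp β s ((-1 : ℝ) + y * Complex.I) := by
    linear_combination rect
  rw [eq]
  refine (norm_add_le _ _).trans ((add_le_add_left (norm_sub_le _ _) _).trans ?_)
  rw [norm_smul, norm_smul, Complex.norm_I, one_mul, one_mul]
  linarith

/-- The Bochner–Riesz multiplier `(1 - s)₊^α` as a function of the squared frequency `s`. -/
noncomputable def brSymbol (α s : ℝ) : ℝ := (max (1 - s) 0) ^ α

lemma continuous_brSymbol {α : ℝ} (hα : 0 ≤ α) : Continuous (brSymbol α) :=
  (Real.continuous_rpow_const hα).comp (by fun_prop)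

lemma brSymbol_of_one_le {α s : ℝ} (hα : 0 < α) (hs : 1 ≤ s) : brSymbol α s = 0 := by
  rw [brSymbol, max_eq_right (by linarith), Real.zero_rpow hα.ne']

lemma brSymbol_mul_sub {α t u : ℝ} (ht : t ≤ 1) :
    brSymbol α (t + (1 - t) * u) = (1 - t) ^ α * brSymbol α u := by
  have h0 : 0 ≤ 1 - t := by linarith
  rw [brSymbol, brSymbol, ← Real.mul_rpow h0 (le_max_right _ _), mul_max_of_nonneg _ _ h0]
  ring_nf

lemma continuous_mul_brSymbol {E : Type*} [NormedAddCommGroup E] {α R : ℝ} (hα : 0 < α)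
    {g : E → ℂ} (hg : Continuous g) :
    Continuous fun ξ : E ↦ g ξ * (brSymbol α (‖ξ‖ ^ 2 / R ^ 2) : ℂ) :=
  hg.mul (Complex.continuous_ofReal.comp ((continuous_brSymbol hα.le).comp (by fun_prop)))

lemma integrable_mul_brSymbol {E : Type*} [NormedAddCommGroup E] [ProperSpace E]
    [MeasurableSpace E] [BorelSpace E] {μ : Measure E} [IsFiniteMeasureOnCompacts μ]
    {α R : ℝ} (hα : 0 < α) (hR : 0 < R) {g : E → ℂ} (hg : Continuous g) :
    Integrable (fun ξ : E ↦ g ξ * (brSymbol α (‖ξ‖ ^ 2 / R ^ 2) : ℂ)) μ := by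
  refine (continuous_mul_brSymbol hα hg).integrable_of_hasCompactSupport ?_
  refine HasCompactSupport.of_support_subset_isCompact (isCompact_closedBall (0 : E) R) ?_
  intro ξ hξ
  by_contra h
  rw [mem_closedBall_zero_iff, not_le] at h
  refine hξ ?_
  have : 1 ≤ ‖ξ‖ ^ 2 / R ^ 2 := by
    rw [one_le_div (by positivity)]
    gcongr
  simp [brSymbol_of_one_le hα this]

lemma integral_brSymbol_add_sum_sq (m : ℕ) {α : ℝ} (hα : 0 < α) (t : ℝ) :
    ∫ y : Fin m → ℝ, brSymbol α (t + ∑ i, y i ^ 2) =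
      (∫ y : Fin m → ℝ, brSymbol α (∑ i, y i ^ 2)) * brSymbol (α + m / 2) t := by
  have hβ : 0 < α + m / 2 := by positivity
  rcases le_or_gt 1 t with ht | ht
  · rw [brSymbol_of_one_le hβ ht, mul_zero]
    refine integral_eq_zero_of_ae (.of_forall fun y ↦ brSymbol_of_one_le hα ?_)
    have : 0 ≤ ∑ i, y i ^ 2 := Finset.sum_nonneg fun i _ ↦ sq_nonneg _
    linarith
  · have h0 : 0 < 1 - t := by linarith
    have scale := Measure.integral_comp_smul (volume : Measure (Fin m → ℝ))
      (fun y ↦ brSymbol α (t + ∑ i, y i ^ 2)) (√(1 - t))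
    simp only [Pi.smul_apply, smul_eq_mul, mul_pow, Real.sq_sqrt h0.le, ← Finset.mul_sum,
      brSymbol_mul_sub ht.le, integral_const_mul, Module.finrank_fin_fun] at scale
    have hpow : √(1 - t) ^ m = (1 - t) ^ ((m : ℝ) / 2) := by
      rw [Real.sqrt_eq_rpow, ← Real.rpow_natCast, ← Real.rpow_mul h0.le]
      ring_nf
    have hpos : 0 < (1 - t) ^ ((m : ℝ) / 2) := by positivity
    rw [hpow, abs_of_pos (by positivity), eq_inv_mul_iff_mul_eq₀ hpos.ne'] at scale
    rw [← scale, brSymbol, max_eq_left h0.le, Real.rpow_add h0]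
    ring

lemma exists_linearIsometryEquiv_apply_eq {E : Type*} [NormedAddCommGroup E]
    [InnerProductSpace ℝ E] {v w : E} (h : ‖v‖ = ‖w‖) : ∃ ρ : E ≃ₗᵢ[ℝ] E, ρ v = w :=
  ⟨_, Submodule.reflection_sub h⟩

lemma BRkernel_eq_of_norm_eq {n : ℕ} {R α : ℝ} {v w : EuclideanSpace ℝ (Fin n)}
    (h : ‖v‖ = ‖w‖) : BRkernel n R α v = BRkernel n R α w := by
  obtain ⟨ρ, rfl⟩ := exists_linearIsometryEquiv_apply_eq h
  symm
  rw [BRkernel, BRkernel, ← ρ.measurePreserving.integral_comp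
    ρ.toHomeomorph.measurableEmbedding]
  simp

/-- Integrating out the directions orthogonal to `z` writes the kernel as a one-dimensional
Fourier transform. -/
lemma BRkernel_eq_integral_brSymbol (m : ℕ) {α : ℝ} (hα : 0 < α)
    (z : EuclideanSpace ℝ (Fin (m + 1))) :
    BRkernel (m + 1) 1 α z = (∫ y : Fin m → ℝ, brSymbol α (∑ i, y i ^ 2) : ℝ) *
      ∫ t : ℝ, Complex.exp ((2 * Real.pi * ‖z‖ : ℝ) * t * Complex.I) *
        (brSymbol (α + m / 2) (t ^ 2) : ℂ) := by
  have hz : ‖z‖ = ‖EuclideanSpace.single (0 : Fin (m + 1)) ‖z‖‖ := by simp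
  rw [BRkernel_eq_of_norm_eq hz]
  let e : ℝ × (Fin m → ℝ) ≃ᵐ EuclideanSpace ℝ (Fin (m + 1)) :=
    ((MeasurableEquiv.toLp 2 (Fin (m + 1) → ℝ)).symm.trans
      (MeasurableEquiv.piFinSuccAbove (fun _ ↦ ℝ) 0)).symm
  have mp : MeasurePreserving e := MeasurePreserving.symm _
    ((EuclideanSpace.volume_preserving_symm_measurableEquiv_toLp (Fin (m + 1))).trans
      (volume_preserving_piFinSuccAbove (fun _ ↦ ℝ) 0))
  have he0 (p : ℝ × (Fin m → ℝ)) : e p 0 = p.1 := by simp [e]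
  have hen (p : ℝ × (Fin m → ℝ)) : ‖e p‖ ^ 2 = p.1 ^ 2 + ∑ i, p.2 i ^ 2 := by
    simp [e, EuclideanSpace.norm_sq_eq, Fin.sum_univ_succ]
  have hint := (mp.integrable_comp_emb e.measurableEmbedding).2
    (integrable_mul_brSymbol (R := 1) (μ := volume) hα one_pos
      (g := fun ξ : EuclideanSpace ℝ (Fin (m + 1)) ↦
        Complex.exp ((2 * Real.pi * ‖z‖ : ℝ) * (ξ 0 : ℝ) * Complex.I)) (by fun_prop))
  simp only [Function.comp_def, he0, hen, one_pow, div_one] at hint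
  calc _ = ∫ ξ : EuclideanSpace ℝ (Fin (m + 1)),
        Complex.exp ((2 * Real.pi * ‖z‖ : ℝ) * (ξ 0 : ℝ) * Complex.I) *
          (brSymbol α (‖ξ‖ ^ 2) : ℂ) := by
        simp only [BRkernel, brSymbol, EuclideanSpace.inner_single_left]
        congr! 4
        · simp
          ring
        · simp
    _ = ∫ p : ℝ × (Fin m → ℝ), Complex.exp ((2 * Real.pi * ‖z‖ : ℝ) * p.1 * Complex.I) *
          (brSymbol α (p.1 ^ 2 + ∑ i, p.2 i ^ 2) : ℂ) := by
        rw [← mp.integral_comp e.measurableEmbedding]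
        simp only [he0, hen]
    _ = _ := by
        rw [Measure.volume_eq_prod, integral_prod _ hint]
        simp only [integral_const_mul, integral_complex_ofReal, integral_brSymbol_add_sum_sq m hα]
        rw [← integral_const_mul]
        congr! 2 with t
        push_cast
        ring

lemma integral_mul_brSymbol_sq {β : ℝ} (hβ : 0 < β) (s : ℝ) :
    ∫ t : ℝ, Complex.exp (s * t * Complex.I) * (brSymbol β (t ^ 2) : ℂ) =
      ∫ t in (-1 : ℝ)..1, jacobiExp β s t := by
  rw [intervalIntegral.integral_of_le (by norm_num), ← integral_indicator measurableSet_Ioc]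
  congr with t
  by_cases ht : t ∈ Set.Ioc (-1 : ℝ) 1
  · have : 0 ≤ 1 - t ^ 2 := by nlinarith [ht.1, ht.2]
    rw [Set.indicator_of_mem ht, brSymbol, jacobiExp, max_eq_left this,
      Complex.ofReal_cpow this, mul_comm]
    push_cast
    rfl
  · rw [Set.indicator_of_notMem ht, brSymbol_of_one_le hβ, Complex.ofReal_zero, mul_zero]
    rw [one_le_sq_iff_one_le_abs, le_abs']
    rw [Set.mem_Ioc, not_and_or, not_lt, not_le] at ht
    exact ht.imp id le_of_lt

lemma norm_BRkernel_le {n : ℕ} {R α : ℝ} (z : EuclideanSpace ℝ (Fin n)) :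
    ‖BRkernel n R α z‖ ≤
      ∫ ξ : EuclideanSpace ℝ (Fin n), ‖(brSymbol α (‖ξ‖ ^ 2 / R ^ 2) : ℂ)‖ := by
  refine (norm_integral_le_integral_norm _).trans_eq ?_
  simp only [norm_mul, Complex.norm_exp_ofReal_mul_I, one_mul, brSymbol]

lemma BRkernel_eq_fourierInv (n : ℕ) (R α : ℝ) :
    BRkernel n R α = FourierTransformInv.fourierInv
      (fun ξ : EuclideanSpace ℝ (Fin n) ↦ (brSymbol α (‖ξ‖ ^ 2 / R ^ 2) : ℂ)) := by
  ext z
  simp only [BRkernel, Real.fourierInv_eq', real_inner_comm, smul_eq_mul, brSymbol]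

lemma BRkernel_eq_fourier (n : ℕ) (R α : ℝ) :
    BRkernel n R α = FourierTransform.fourier
      (fun ξ : EuclideanSpace ℝ (Fin n) ↦ (brSymbol α (‖ξ‖ ^ 2 / R ^ 2) : ℂ)) := by
  ext z
  rw [BRkernel_eq_of_norm_eq (norm_neg z).symm, BRkernel_eq_fourierInv,
    Real.fourierInv_eq_fourier_neg, neg_neg]

lemma integrable_brSymbol {n : ℕ} {R α : ℝ} (hα : 0 < α) (hR : 0 < R) :
    Integrable (fun ξ : EuclideanSpace ℝ (Fin n) ↦ (brSymbol α (‖ξ‖ ^ 2 / R ^ 2) : ℂ)) := by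
  simpa using integrable_mul_brSymbol (E := EuclideanSpace ℝ (Fin n)) (μ := volume) hα hR
    (continuous_const (y := (1 : ℂ)))

lemma continuous_brSymbol_norm {n : ℕ} {R α : ℝ} (hα : 0 < α) :
    Continuous (fun ξ : EuclideanSpace ℝ (Fin n) ↦ (brSymbol α (‖ξ‖ ^ 2 / R ^ 2) : ℂ)) := by
  simpa using continuous_mul_brSymbol (E := EuclideanSpace ℝ (Fin n)) (R := R) hα
    (continuous_const (y := (1 : ℂ)))

lemma continuous_BRkernel {n : ℕ} {R α : ℝ} (hα : 0 < α) (hR : 0 < R) :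
    Continuous (BRkernel n R α) := by
  rw [BRkernel_eq_fourier]
  exact VectorFourier.fourierIntegral_continuous Real.continuous_fourierChar
    (by exact continuous_inner) (integrable_brSymbol hα hR)

theorem integrable_BRkernel {n : ℕ} (hn : 1 ≤ n) {α : ℝ} (hα : ((n : ℝ) - 1) / 2 < α) :
    Integrable (BRkernel n 1 α) := by
  obtain ⟨m, rfl⟩ := Nat.exists_eq_add_of_le' hn
  push_cast at hα
  have hm : (0 : ℝ) ≤ m := m.cast_nonneg
  have hα0 : 0 < α := by linarith
  have hβ : 0 < α + m / 2 := by positivity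
  obtain ⟨C, hC⟩ := exists_norm_integral_jacobiExp_le hβ
  set c : ℂ := ((∫ y : Fin m → ℝ, brSymbol α (∑ i, y i ^ 2) : ℝ) : ℂ)
  set A := ∫ ξ : EuclideanSpace ℝ (Fin (m + 1)), ‖(brSymbol α (‖ξ‖ ^ 2 / 1 ^ 2) : ℂ)‖
  set p : ℝ := α + m / 2 + 1 with hp
  have hA0 : 0 ≤ A := integral_nonneg fun _ ↦ norm_nonneg _
  have hC0 : 0 ≤ C := by simpa using (norm_nonneg _).trans (hC 1 one_pos)
  have decay : Integrable (fun z : EuclideanSpace ℝ (Fin (m + 1)) ↦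
      (A + ‖c‖ * C) * 2 ^ p * (1 + ‖z‖) ^ (-p)) := by
    refine (integrable_one_add_norm ?_).const_mul _
    rw [finrank_euclideanSpace_fin]
    push_cast
    linarith
  refine decay.mono' (continuous_BRkernel hα0 one_pos).aestronglyMeasurable (.of_forall fun z ↦ ?_)
  have h1 : 0 < 1 + ‖z‖ := by positivity
  rw [mul_assoc]
  have hK : 0 ≤ ‖c‖ * C := by positivity
  rcases le_or_gt ‖z‖ 1 with hz | hz
  · have : 1 ≤ (2 : ℝ) ^ p * (1 + ‖z‖) ^ (-p) := by
      rw [Real.rpow_neg h1.le, ← div_eq_mul_inv, one_le_div (by positivity)]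
      gcongr
      linarith
    calc _ ≤ A := norm_BRkernel_le z
      _ ≤ (A + ‖c‖ * C) * 1 := by linarith
      _ ≤ _ := by gcongr
  · have hs : 0 < 2 * Real.pi * ‖z‖ := by positivity
    have : (2 * Real.pi * ‖z‖) ^ (-p) ≤ (2 : ℝ) ^ p * (1 + ‖z‖) ^ (-p) := by
      rw [Real.rpow_neg h1.le, ← div_eq_mul_inv, ← Real.div_rpow (by norm_num) h1.le,
        Real.rpow_neg hs.le, ← Real.inv_rpow hs.le]
      gcongr
      rw [inv_le_comm₀ hs (by positivity), inv_div]
      nlinarith [Real.pi_gt_three]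
    rw [BRkernel_eq_integral_brSymbol m hα0, integral_mul_brSymbol_sq hβ, norm_mul]
    calc _ ≤ ‖c‖ * (C * (2 * Real.pi * ‖z‖) ^ (-p)) := by
          gcongr
          exact hC _ hs
      _ ≤ ‖c‖ * (C * ((2 : ℝ) ^ p * (1 + ‖z‖) ^ (-p))) := by gcongr
      _ ≤ _ := by
          rw [← mul_assoc]
          gcongr
          linarith

lemma integral_BRkernel {n : ℕ} (hn : 1 ≤ n) {α : ℝ} (hα : ((n : ℝ) - 1) / 2 < α) :
    ∫ z, BRkernel n 1 α z = 1 := by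
  have hα0 : 0 < α := by
    have : (1 : ℝ) ≤ n := by exact_mod_cast hn
    linarith
  have hK := integrable_BRkernel hn hα
  rw [BRkernel_eq_fourier] at hK
  have inv := (continuous_brSymbol_norm (n := n) (R := 1) hα0).fourier_fourierInv_eq
    (integrable_brSymbol hα0 one_pos) hK
  rw [← BRkernel_eq_fourierInv] at inv
  simpa [Real.fourier_eq', brSymbol] using congrFun inv 0

lemma fourierT_eq_fourier (n : ℕ) (f : EuclideanSpace ℝ (Fin n) → ℂ) :
    fourierT n f = FourierTransform.fourier f := by
  ext ξ
  simp [fourierT, Real.fourier_eq']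

lemma BRkernel_eq_pow_mul (n : ℕ) {R : ℝ} (hR : 0 < R) (α : ℝ) (z : EuclideanSpace ℝ (Fin n)) :
    BRkernel n R α z = (R : ℂ) ^ n * BRkernel n 1 α (R • z) := by
  have h := Measure.integral_comp_smul (volume : Measure (EuclideanSpace ℝ (Fin n)))
    (fun ξ ↦ Complex.exp ((2 * Real.pi * ⟪z, ξ⟫ : ℝ) * Complex.I) *
      (((max (1 - ‖ξ‖ ^ 2 / R ^ 2) 0) ^ α : ℝ) : ℂ)) R
  have hR' : (R : ℂ) ^ n ≠ 0 := by
    simp [hR.ne']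
  have e (ξ : EuclideanSpace ℝ (Fin n)) : ‖R • ξ‖ ^ 2 / R ^ 2 = ‖ξ‖ ^ 2 / 1 ^ 2 := by
    rw [norm_smul, mul_pow, Real.norm_eq_abs, sq_abs]
    field_simp
  simp only [e, inner_smul_right, finrank_euclideanSpace_fin] at h
  simp only [BRkernel, inner_smul_left, RCLike.conj_to_real]
  rw [h, abs_of_pos (by positivity), Complex.real_smul]
  push_cast
  rw [mul_inv_cancel_left₀ hR']

lemma BR_eq_convolution {n : ℕ} {R α : ℝ} (hα : 0 < α) (hR : 0 < R)
    {f : EuclideanSpace ℝ (Fin n) → ℂ} (hf : Integrable f) (t : EuclideanSpace ℝ (Fin n)) :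
    BR n R α f t = ∫ x, f x * BRkernel n R α (t - x) := by
  have hg : Integrable (fun ξ : EuclideanSpace ℝ (Fin n) ↦
      Complex.exp ((2 * Real.pi * ⟪t, ξ⟫ : ℝ) * Complex.I) *
        (brSymbol α (‖ξ‖ ^ 2 / R ^ 2) : ℂ)) :=
    integrable_mul_brSymbol hα hR (by fun_prop)
  have key := VectorFourier.integral_fourierIntegral_smul_eq_flip
    (L := innerₗ (EuclideanSpace ℝ (Fin n))) Real.continuous_fourierChar
    continuous_inner hf hg
  rw [flip_innerₗ] at key
  have hker (x : EuclideanSpace ℝ (Fin n)) : FourierTransform.fourier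
      (fun ξ : EuclideanSpace ℝ (Fin n) ↦
        Complex.exp ((2 * Real.pi * ⟪t, ξ⟫ : ℝ) * Complex.I) *
          (brSymbol α (‖ξ‖ ^ 2 / R ^ 2) : ℂ)) x = BRkernel n R α (t - x) := by
    rw [Real.fourier_eq', BRkernel]
    congr with ξ
    rw [smul_eq_mul, ← mul_assoc, ← Complex.exp_add, inner_sub_left, real_inner_comm x ξ, brSymbol]
    congr 2
    push_cast
    ring
  calc BR n R α f t = ∫ ξ, FourierTransform.fourier f ξ •
        (Complex.exp ((2 * Real.pi * ⟪t, ξ⟫ : ℝ) * Complex.I) *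
          (brSymbol α (‖ξ‖ ^ 2 / R ^ 2) : ℂ)) := by
        rw [BR, fourierT_eq_fourier]
        congr with ξ
        rw [smul_eq_mul, mul_comm, brSymbol]
    _ = _ := key
    _ = _ := by
        congr with x
        rw [smul_eq_mul, ← hker x]
        rfl

lemma BR_eq_integral_mul_BRkernel {n : ℕ} {R α : ℝ} (hα : 0 < α) (hR : 0 < R)
    {f : EuclideanSpace ℝ (Fin n) → ℂ} (hf : Integrable f) (t : EuclideanSpace ℝ (Fin n)) :
    BR n R α f t = ∫ x, f (t - R⁻¹ • x) * BRkernel n 1 α x := by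
  have h := Measure.integral_comp_smul (volume : Measure (EuclideanSpace ℝ (Fin n)))
    (fun x ↦ f (t - R⁻¹ • x) * BRkernel n 1 α x) R
  have hR' : (R : ℂ) ^ n ≠ 0 := by
    simp [hR.ne']
  rw [BR_eq_convolution hα hR hf, ← integral_sub_left_eq_self _ _ t]
  simp only [sub_sub_cancel, BRkernel_eq_pow_mul n hR, mul_left_comm _ ((R : ℂ) ^ n)]
  simp only [inv_smul_smul₀ hR.ne', finrank_euclideanSpace_fin] at h
  rw [integral_const_mul, h, abs_of_pos (by positivity), Complex.real_smul]
  push_cast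
  rw [mul_inv_cancel_left₀ hR']

lemma tendsto_integral_indicator_norm_inv_smul {E : Type*} [NormedAddCommGroup E]
    [NormedSpace ℝ E] [MeasurableSpace E] [BorelSpace E] {μ : Measure E}
    {g : E → ℝ} (hg : Integrable g μ) {δ : ℝ} (hδ : 0 < δ) :
    Tendsto (fun R : ℝ ↦ ∫ x, {x : E | δ ≤ ‖R⁻¹ • x‖}.indicator g x ∂μ) atTop (nhds 0) := by
  have hmeas (R : ℝ) : MeasurableSet {x : E | δ ≤ ‖R⁻¹ • x‖} :=
    (isClosed_le continuous_const (by fun_prop)).measurableSet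
  rw [← integral_zero E ℝ (μ := μ)]
  refine tendsto_integral_filter_of_dominated_convergence (fun x ↦ ‖g x‖)
    (.of_forall fun R ↦ (hg.indicator (hmeas R)).aestronglyMeasurable)
    (.of_forall fun R ↦ .of_forall fun x ↦ norm_indicator_le_norm_self _ _) hg.norm
    (.of_forall fun x ↦ ?_)
  have hx : Tendsto (fun R : ℝ ↦ ‖R⁻¹ • x‖) atTop (nhds 0) := by
    simpa using ((tendsto_inv_atTop_zero (𝕜 := ℝ)).smul_const x).norm
  refine tendsto_const_nhds.congr' ?_
  filter_upwards [hx.eventually_lt_const hδ] with R hR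
  rw [Set.indicator_of_notMem (by simpa using hR)]

/-- for `α > (n-1)/2` and `f ∈ L¹` bounded and uniformly continuous,
the Bochner–Riesz means converge uniformly to `f` as `R → ∞`. -/
theorem bochnerRiesz_tendstoUniformly (n : ℕ) (hn : 1 ≤ n) (α : ℝ)
    (hα : ((n : ℝ) - 1) / 2 < α)
    (f : EuclideanSpace ℝ (Fin n) → ℂ) (hf1 : Integrable f)
    (hbdd : ∃ M : ℝ, ∀ t, ‖f t‖ ≤ M) (huc : UniformContinuous f) :
    TendstoUniformly (fun (R : ℝ) (t : EuclideanSpace ℝ (Fin n)) => BR n R α f t)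
      f atTop := by
  have hα0 : 0 < α := by
    have : (1 : ℝ) ≤ n := by exact_mod_cast hn
    linarith
  obtain ⟨M, hM⟩ := hbdd
  have hM0 : 0 ≤ M := (norm_nonneg _).trans (hM 0)
  have hK := integrable_BRkernel hn hα
  set A := ∫ x, ‖BRkernel n 1 α x‖
  have hA0 : 0 ≤ A := integral_nonneg fun _ ↦ norm_nonneg _
  rw [Metric.tendstoUniformly_iff]
  intro ε hε
  obtain ⟨δ, hδ, hfδ⟩ := Metric.uniformContinuous_iff.1 huc (ε / (2 * (A + 1))) (by positivity)
  have htail := (tendsto_integral_indicator_norm_inv_smul hK.norm hδ).const_mul (2 * M)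
  rw [mul_zero] at htail
  filter_upwards [htail.eventually_lt_const (half_pos hε), eventually_gt_atTop 0] with R hR hR0 t
  set S := {x : EuclideanSpace ℝ (Fin n) | δ ≤ ‖R⁻¹ • x‖}
  have hS : MeasurableSet S := (isClosed_le continuous_const (by fun_prop)).measurableSet
  have hfcont : Continuous fun x ↦ f (t - R⁻¹ • x) := huc.continuous.comp (by fun_prop)
  have hdiff : BR n R α f t - f t = ∫ x, (f (t - R⁻¹ • x) - f t) * BRkernel n 1 α x := by
    simp only [sub_mul]
    rw [integral_sub (hK.bdd_mul hfcont.aestronglyMeasurable (.of_forall fun x ↦ hM _))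
      (hK.const_mul _), integral_const_mul, integral_BRkernel hn hα, mul_one,
      BR_eq_integral_mul_BRkernel hα0 hR0 hf1]
  rw [dist_comm, dist_eq_norm, hdiff]
  calc _ ≤ ∫ x, (ε / (2 * (A + 1)) * ‖BRkernel n 1 α x‖ +
          2 * M * S.indicator (fun x ↦ ‖BRkernel n 1 α x‖) x) := by
        refine norm_integral_le_of_norm_le ((hK.norm.const_mul _).add
          ((hK.norm.indicator hS).const_mul _)) (.of_forall fun x ↦ ?_)
        rw [norm_mul]
        by_cases hx : x ∈ S
        · rw [Set.indicator_of_mem hx, ← add_mul]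
          gcongr
          have : 0 ≤ ε / (2 * (A + 1)) := by positivity
          linarith [norm_sub_le (f (t - R⁻¹ • x)) (f t), hM (t - R⁻¹ • x), hM t]
        · rw [Set.indicator_of_notMem hx, mul_zero, add_zero]
          gcongr
          rw [← dist_eq_norm]
          refine (hfδ ?_).le
          rw [dist_eq_norm, sub_sub_cancel_left, norm_neg]
          exact not_le.1 hx
    _ = ε / (2 * (A + 1)) * A + 2 * M * ∫ x, S.indicator (fun x ↦ ‖BRkernel n 1 α x‖) x := by
        rw [integral_add (hK.norm.const_mul _) ((hK.norm.indicator hS).const_mul _),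
          integral_const_mul, integral_const_mul]
    _ < ε / 2 + ε / 2 := by
        refine add_lt_add_of_le_of_lt ?_ hR
        rw [div_mul_eq_mul_div, div_le_div_iff₀ (by positivity) two_pos]
        nlinarith
    _ = ε := add_halves ε
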